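/- Let E be a centrally orthocomplete pseudo-effect algebra. Then the central cover mapping γ : E → Γ(E), assigning to each e ∈ E its central cover γe, is a surjective hull mapping on E; that is, γ0 = 0, e ≤ γe for all e ∈ E, γ(e ∧ γf) = γe ∧ γf for all e,f ∈ E, and γE = Γ(E). -/

import Mathlib

namespace PEApaper

/-- The bare data of a partial-addition structure: a partial binary operation
(encoded via `Option`) together with constants `0` and `1`. -/
structure PartialStruct (E : Type) where
  padd : E → E → Option E
  zero : E
  one : E

namespace PartialStruct

variable {E : Type}

/-- `a ≤ b` iff `a + c = b` for some `c`. -/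
def le (P : PartialStruct E) (a b : E) : Prop := ∃ c, P.padd a c = some b

/-- `m` is the greatest lower bound (meet `a ∧ b`) of `a` and `b`. -/
def IsMeet (P : PartialStruct E) (a b m : E) : Prop :=
  P.le m a ∧ P.le m b ∧ ∀ x, P.le x a → P.le x b → P.le x m

/-- `j` is the least upper bound (join `a ∨ b`) of `a` and `b`. -/
def IsJoin (P : PartialStruct E) (a b j : E) : Prop :=
  P.le a j ∧ P.le b j ∧ ∀ x, P.le a x → P.le b x → P.le j x

/-- `s` is the supremum of the set `S`. -/
def IsSup (P : PartialStruct E) (S : Set E) (s : E) : Prop :=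
  (∀ x ∈ S, P.le x s) ∧ ∀ u, (∀ x ∈ S, P.le x u) → P.le s u

/-- Left-associated partial sum of a list, continuing from `acc`. -/
def IsSumFrom (P : PartialStruct E) : E → List E → E → Prop
  | acc, [], s => s = acc
  | acc, a :: l, s => ∃ t, P.padd acc a = some t ∧ IsSumFrom P t l s

/-- `s` is the (left-associated) orthosum `e₁ + e₂ + ⋯ + eₙ` of the list. -/
def IsSumList (P : PartialStruct E) (l : List E) (s : E) : Prop :=
  match l with
  | [] => s = P.zero
  | a :: t => IsSumFrom P a t s

/-- `c` is a central element: there is a PEA-isomorphism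
`f : E → E[0,c] × E[0,c∼]` with `f c = (c,0)` such that `f x = (x₁,x₂)`
implies `x = x₁ + x₂`.  The isomorphism onto the product of the two
interval pseudo-effect algebras is spelled out explicitly. -/
def IsCentral (P : PartialStruct E) (c : E) : Prop :=
  ∃ cs, P.padd c cs = some P.one ∧
    ∃ f : E → E × E,
      (∀ x, P.le (f x).1 c ∧ P.le (f x).2 cs) ∧
      Function.Injective f ∧
      (∀ y : E × E, P.le y.1 c → P.le y.2 cs → ∃ x, f x = y) ∧
      f c = (c, P.zero) ∧
      f P.one = (c, cs) ∧
      (∀ x, P.padd (f x).1 (f x).2 = some x) ∧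
      (∀ a b ab, P.padd a b = some ab →
        P.padd (f a).1 (f b).1 = some (f ab).1 ∧
        P.padd (f a).2 (f b).2 = some (f ab).2) ∧
      (∀ a b s t, P.padd (f a).1 (f b).1 = some s → P.le s c →
        P.padd (f a).2 (f b).2 = some t → P.le t cs →
        ∃ ab, P.padd a b = some ab)

/-- The center `Γ(E)`. -/
def center (P : PartialStruct E) : Set E := {c | P.IsCentral c}

/-- The central interval `Γ(E)[0,c] = Γ(E) ∩ E[0,c]`. -/
def centerIntervalSet (P : PartialStruct E) (c : E) : Set E :=
  {x | P.IsCentral x ∧ P.le x c}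

/-- A Γ-orthogonal family: one dominated elementwise by a pairwise
disjoint family of central elements. -/
def GammaOrthogonal (P : PartialStruct E) {I : Type} (e : I → E) : Prop :=
  ∃ c : I → E, (∀ i, P.IsCentral (c i)) ∧
    (∀ i j, i ≠ j → P.IsMeet (c i) (c j) P.zero) ∧
    ∀ i, P.le (e i) (c i)

/-- Centrally orthocomplete: every Γ-orthogonal family has a supremum. -/
def IsCOPEA (P : PartialStruct E) : Prop :=
  ∀ (I : Type) (e : I → E), P.GammaOrthogonal e → ∃ s, P.IsSup (Set.range e) s

/-- `c` is the central cover of `e`: the smallest central element above `e`. -/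
def IsCentralCover (P : PartialStruct E) (c e : E) : Prop :=
  P.IsCentral c ∧ P.le e c ∧ ∀ d, P.IsCentral d → P.le e d → P.le c d

/-- `[Q]`: the set of all suprema of Γ-orthogonal families of elements of `Q`. -/
def bra (P : PartialStruct E) (Q : Set E) : Set E :=
  {s | ∃ (I : Type) (e : I → E), (∀ i, e i ∈ Q) ∧ P.GammaOrthogonal e ∧
    P.IsSup (Set.range e) s}

/-- `Q^γ = {q ∧ c : q ∈ Q, c ∈ Γ(E)}`. -/
def gammaClosure (P : PartialStruct E) (Q : Set E) : Set E :=
  {m | ∃ q ∈ Q, ∃ c, P.IsCentral c ∧ P.IsMeet q c m}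

/-- `Q↓ = ⋃_{q ∈ Q} E[0,q]`. -/
def downSet (P : PartialStruct E) (Q : Set E) : Set E :=
  {e | ∃ q ∈ Q, P.le e q}

/-- `Q' = {e ∈ E : q ∧ e = 0 for all q ∈ Q}`. -/
def commutant (P : PartialStruct E) (Q : Set E) : Set E :=
  {e | ∀ q ∈ Q, P.IsMeet q e P.zero}

/-- A type-determining (TD) set: `K = [K] = K^γ`. -/
def IsTD (P : PartialStruct E) (K : Set E) : Prop :=
  P.bra K = K ∧ P.gammaClosure K = K

/-- A strongly type-determining (STD) set: `K = [K] = K↓`. -/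
def IsSTD (P : PartialStruct E) (K : Set E) : Prop :=
  P.bra K = K ∧ P.downSet K = K

/-- `c` is the type-cover of `K` (w.r.t. the central cover map `γ`):
the unique central element with `γK = Γ(E)[0,c]`. -/
def IsTypeCover (P : PartialStruct E) (γ : E → E) (K : Set E) (c : E) : Prop :=
  P.IsCentral c ∧ γ '' K = P.centerIntervalSet c

/-- An atom: a nonzero element with no proper nonzero subelement. -/
def IsAtom' (P : PartialStruct E) (a : E) : Prop :=
  a ≠ P.zero ∧ ∀ x, P.le x a → x = P.zero ∨ x = a

end PartialStruct

/-- A PEA-isomorphism between two partial-addition structures: a bijective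
morphism whose inverse is a morphism. -/
structure IsPEAIso {A B : Type} (P : PartialStruct A) (Q : PartialStruct B)
    (f : A → B) : Prop where
  bijective : Function.Bijective f
  map_one : f P.one = Q.one
  map_add : ∀ a b ab, P.padd a b = some ab → Q.padd (f a) (f b) = some (f ab)
  rev_add : ∀ a b s, Q.padd (f a) (f b) = some s → ∃ ab, P.padd a b = some ab

open scoped Classical in
/-- The (coordinatewise) product of a family of partial structures. -/
noncomputable def prodStruct {I : Type} {A : I → Type}
    (Ps : ∀ i, PartialStruct (A i)) : PartialStruct (∀ i, A i) where
  padd a b :=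
    if h : ∀ i, ∃ s, (Ps i).padd (a i) (b i) = some s
    then some fun i => Classical.choose (h i)
    else none
  zero := fun i => (Ps i).zero
  one := fun i => (Ps i).one

/-- A pseudo-effect algebra. -/
structure PEA (E : Type) extends PartialStruct E where
  assoc_def : ∀ a b c : E,
    (∃ ab, padd a b = some ab ∧ ∃ x, padd ab c = some x) ↔
    (∃ bc, padd b c = some bc ∧ ∃ y, padd a bc = some y)
  assoc_eq : ∀ a b c ab bc x y, padd a b = some ab → padd ab c = some x →
    padd b c = some bc → padd a bc = some y → x = y
  exu_right : ∀ a : E, ∃! d, padd a d = some one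
  exu_left : ∀ a : E, ∃! e, padd e a = some one
  shift : ∀ a b ab, padd a b = some ab →
    (∃ d, padd d a = some ab) ∧ (∃ e, padd b e = some ab)
  one_add : ∀ a x, padd one a = some x → a = zero
  add_one : ∀ a x, padd a one = some x → a = zero

namespace PEA

variable {E : Type} (P : PEA E)

/-- Shorthand for the underlying partial structure. -/
abbrev ps : PartialStruct E := P.toPartialStruct

theorem one_add_zero : P.padd P.one P.zero = some P.one := by
  obtain ⟨d, hd, -⟩ := P.exu_right P.one
  have h := P.one_add d P.one hd
  rwa [h] at hd

theorem zero_add_one : P.padd P.zero P.one = some P.one := by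
  obtain ⟨e, he, -⟩ := P.exu_left P.one
  have h := P.add_one e P.one he
  rwa [h] at he

theorem padd_zero (a : E) : P.padd a P.zero = some a := by
  obtain ⟨e, he, -⟩ := P.exu_left a
  have h1 : ∃ ab, P.padd e a = some ab ∧ ∃ x, P.padd ab P.zero = some x :=
    ⟨P.one, he, P.one, P.one_add_zero⟩
  obtain ⟨t, ht, y, hy⟩ := (P.assoc_def e a P.zero).mp h1
  have hxy : P.one = y :=
    P.assoc_eq e a P.zero P.one t P.one y he P.one_add_zero ht hy
  obtain ⟨d, hd, hu⟩ := P.exu_right e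
  have hta : t = a := by
    have h2 : t = d := hu t (by rw [← hxy] at hy; exact hy)
    have h3 : a = d := hu a he
    rw [h2, h3]
  rwa [hta] at ht

theorem zero_padd (a : E) : P.padd P.zero a = some a := by
  obtain ⟨d, hd, -⟩ := P.exu_right a
  have h1 : ∃ bc, P.padd a d = some bc ∧ ∃ y, P.padd P.zero bc = some y :=
    ⟨P.one, hd, P.one, P.zero_add_one⟩
  obtain ⟨t, ht, y, hy⟩ := (P.assoc_def P.zero a d).mpr h1
  have hxy : y = P.one :=
    P.assoc_eq P.zero a d t P.one y P.one ht hy hd P.zero_add_one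
  obtain ⟨e, he, hu⟩ := P.exu_left d
  have hta : t = a := by
    have h2 : t = e := hu t (by rw [hxy] at hy; exact hy)
    have h3 : a = e := hu a hd
    rw [h2, h3]
  rwa [hta] at ht

theorem zero_le (a : E) : P.ps.le P.zero a := ⟨a, P.zero_padd a⟩

theorem le_refl (a : E) : P.ps.le a a := ⟨P.zero, P.padd_zero a⟩

open scoped Classical in
/-- The interval pseudo-effect algebra `E[0,p]` as a partial structure on
the subtype `{x // x ≤ p}`; the sum is defined iff it is defined in `E`
and lies below `p`, and the unit is `p`. -/
noncomputable def intervalStruct (p : E) :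
    PartialStruct {x : E // P.ps.le x p} where
  padd a b := (P.padd a.1 b.1).bind fun s =>
    if h : P.ps.le s p then some ⟨s, h⟩ else none
  zero := ⟨P.zero, P.zero_le p⟩
  one := ⟨p, P.le_refl p⟩

end PEA

/-- The order relation of a complete Boolean algebra structure, made explicit. -/
def cbaLe {X : Type} (inst : CompleteBooleanAlgebra X) (a b : X) : Prop :=
  @LE.le X (by letI := inst; exact inferInstance) a b

end PEApaper

namespace PEApaper.PEA

variable {E : Type} (P : PEA E) {p q p' q' : E → E}

theorem exists_assoc_right {a b c ab x : E} (h : P.padd a b = some ab)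
    (h' : P.padd ab c = some x) : ∃ bc, P.padd b c = some bc ∧ P.padd a bc = some x := by
  obtain ⟨bc, hbc, y, hy⟩ := (P.assoc_def a b c).mp ⟨ab, h, x, h'⟩
  obtain rfl := P.assoc_eq a b c ab bc x y h h' hbc hy
  exact ⟨bc, hbc, hy⟩

theorem exists_assoc_left {a b c bc x : E} (h : P.padd b c = some bc)
    (h' : P.padd a bc = some x) : ∃ ab, P.padd a b = some ab ∧ P.padd ab c = some x := by
  obtain ⟨ab, hab, y, hy⟩ := (P.assoc_def a b c).mpr ⟨bc, h, x, h'⟩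
  obtain rfl := P.assoc_eq a b c ab bc y x hab hy h h'
  exact ⟨ab, hab, hy⟩

theorem padd_left_cancel {a b c x : E} (h : P.padd a b = some x) (h' : P.padd a c = some x) :
    b = c := by
  obtain ⟨z, hz, -⟩ := P.exu_left x
  obtain ⟨t, ht, htb⟩ := P.exists_assoc_left h hz
  obtain ⟨t', ht', htc⟩ := P.exists_assoc_left h' hz
  obtain rfl : t = t' := Option.some.inj (ht.symm.trans ht')
  exact (P.exu_right t).unique htb htc

theorem eq_zero_of_padd_eq_zero {a b : E} (h : P.padd a b = some P.zero) :
    a = P.zero ∧ b = P.zero := by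
  obtain ⟨t, ht, -⟩ := P.exists_assoc_left h P.one_add_zero
  obtain rfl := P.one_add a t ht
  exact ⟨rfl, Option.some.inj ((P.zero_padd b).symm.trans h)⟩

theorem eq_zero_of_le_zero {a : E} (h : P.ps.le a P.zero) : a = P.zero :=
  (P.eq_zero_of_padd_eq_zero h.choose_spec).1

theorem le_trans {a b c : E} (h : P.ps.le a b) (h' : P.ps.le b c) : P.ps.le a c := by
  obtain ⟨u, hu⟩ := h
  obtain ⟨v, hv⟩ := h'
  obtain ⟨w, -, hw⟩ := P.exists_assoc_right hu hv
  exact ⟨w, hw⟩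

theorem le_antisymm {a b : E} (h : P.ps.le a b) (h' : P.ps.le b a) : a = b := by
  obtain ⟨u, hu⟩ := h
  obtain ⟨v, hv⟩ := h'
  obtain ⟨w, hw, haw⟩ := P.exists_assoc_right hu hv
  obtain rfl := P.padd_left_cancel haw (P.padd_zero a)
  obtain ⟨rfl, -⟩ := P.eq_zero_of_padd_eq_zero hw
  exact Option.some.inj ((P.padd_zero a).symm.trans hu)

theorem le_one (a : E) : P.ps.le a P.one := (P.exu_right a).exists

/-- A pair of complementary additive projections of `E`, i.e. a direct decomposition of `E`. -/
structure IsSplitting (p q : E → E) : Prop where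
  map_fst : ∀ a b ab, P.padd a b = some ab → P.padd (p a) (p b) = some (p ab)
  map_snd : ∀ a b ab, P.padd a b = some ab → P.padd (q a) (q b) = some (q ab)
  padd_eq : ∀ x, P.padd (p x) (q x) = some x
  fst_snd : ∀ x, p (q x) = P.zero
  snd_fst : ∀ x, q (p x) = P.zero
  exists_padd : ∀ x y, ∃ z, P.padd (p x) (q y) = some z

namespace IsSplitting

variable {P}

theorem fst_mono (h : P.IsSplitting p q) {a b : E} (hab : P.ps.le a b) : P.ps.le (p a) (p b) := by
  obtain ⟨c, hc⟩ := hab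
  exact ⟨p c, h.map_fst _ _ _ hc⟩

theorem snd_mono (h : P.IsSplitting p q) {a b : E} (hab : P.ps.le a b) : P.ps.le (q a) (q b) := by
  obtain ⟨c, hc⟩ := hab
  exact ⟨q c, h.map_snd _ _ _ hc⟩

theorem fst_eq_self (h : P.IsSplitting p q) {x : E} (hx : q x = P.zero) : p x = x := by
  have := h.padd_eq x
  rw [hx, P.padd_zero] at this
  exact Option.some.inj this

theorem snd_eq_self (h : P.IsSplitting p q) {x : E} (hx : p x = P.zero) : q x = x := by
  have := h.padd_eq x
  rw [hx, P.zero_padd] at this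
  exact Option.some.inj this

theorem snd_eq_zero_of_le (h : P.IsSplitting p q) {x y : E} (hx : P.ps.le x (p y)) :
    q x = P.zero :=
  P.eq_zero_of_le_zero (h.snd_fst y ▸ h.snd_mono hx)

theorem fst_eq_zero_of_le (h : P.IsSplitting p q) {x y : E} (hx : P.ps.le x (q y)) :
    p x = P.zero :=
  P.eq_zero_of_le_zero (h.fst_snd y ▸ h.fst_mono hx)

theorem fst_eq_self_of_le (h : P.IsSplitting p q) {x y : E} (hx : P.ps.le x (p y)) : p x = x :=
  h.fst_eq_self (h.snd_eq_zero_of_le hx)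

theorem snd_eq_self_of_le (h : P.IsSplitting p q) {x y : E} (hx : P.ps.le x (q y)) : q x = x :=
  h.snd_eq_self (h.fst_eq_zero_of_le hx)

theorem fst_fst (h : P.IsSplitting p q) (x : E) : p (p x) = p x :=
  h.fst_eq_self (h.snd_fst x)

theorem snd_snd (h : P.IsSplitting p q) (x : E) : q (q x) = q x :=
  h.snd_eq_self (h.fst_snd x)

theorem fst_le (h : P.IsSplitting p q) (x : E) : P.ps.le (p x) x := ⟨q x, h.padd_eq x⟩

theorem fst_le_fst_one (h : P.IsSplitting p q) (x : E) : P.ps.le (p x) (p P.one) :=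
  h.fst_mono (P.le_one x)

theorem snd_le_snd_one (h : P.IsSplitting p q) (x : E) : P.ps.le (q x) (q P.one) :=
  h.snd_mono (P.le_one x)

theorem fst_eq_and_snd_eq_of_padd (h : P.IsSplitting p q) {x y z : E}
    (hz : P.padd (p x) (q y) = some z) : p z = p x ∧ q z = q y := by
  have h1 := h.map_fst _ _ _ hz
  have h2 := h.map_snd _ _ _ hz
  rw [h.fst_fst, h.fst_snd, P.padd_zero] at h1
  rw [h.snd_fst, h.snd_snd, P.zero_padd] at h2
  exact ⟨(Option.some.inj h1).symm, (Option.some.inj h2).symm⟩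

theorem padd_comm (h : P.IsSplitting p q) {x y z : E} (hz : P.padd (p x) (q y) = some z) :
    P.padd (q y) (p x) = some z := by
  obtain ⟨hp, hq⟩ := h.fst_eq_and_snd_eq_of_padd hz
  obtain ⟨d, hd⟩ := (P.shift _ _ _ hz).2
  have h1 := h.map_fst _ _ _ hd
  have h2 := h.map_snd _ _ _ hd
  rw [h.fst_snd, P.zero_padd, hp] at h1
  rw [h.snd_snd, hq] at h2
  have hd0 := P.padd_left_cancel h2 (P.padd_zero (q y))
  rw [← Option.some.inj h1, h.fst_eq_self hd0]
  exact hd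

theorem symm (h : P.IsSplitting p q) : P.IsSplitting q p where
  map_fst := h.map_snd
  map_snd := h.map_fst
  padd_eq x := h.padd_comm (h.padd_eq x)
  fst_snd := h.snd_fst
  snd_fst := h.fst_snd
  exists_padd x y := by
    obtain ⟨z, hz⟩ := h.exists_padd y x
    exact ⟨z, h.padd_comm hz⟩

/-- Componentwise sums `s` and `t` can be regrouped into the sum of the two elements. -/
theorem padd_padd_comm (h : P.IsSplitting p q) {a b a' b' x y s t z : E}
    (hs : P.padd a (p b) = some s) (ht : P.padd (q a') b' = some t)
    (hx : P.padd a (q a') = some x) (hy : P.padd (p b) b' = some y)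
    (hz : P.padd s t = some z) : P.padd x y = some z := by
  obtain ⟨u, hu, hau⟩ := P.exists_assoc_right hs hz
  obtain ⟨v, hv, hvu⟩ := P.exists_assoc_left ht hu
  obtain ⟨w, hw, hwu⟩ := P.exists_assoc_right (h.padd_comm hv) hvu
  obtain rfl : y = w := Option.some.inj (hy.symm.trans hw)
  obtain ⟨x', hx', hz'⟩ := P.exists_assoc_left hwu hau
  obtain rfl : x = x' := Option.some.inj (hx.symm.trans hx')
  exact hz'

theorem isCentral (h : P.IsSplitting p q) : P.ps.IsCentral (p P.one) := by
  refine ⟨q P.one, h.padd_eq _, fun x => (p x, q x),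
    fun x => ⟨h.fst_le_fst_one x, h.snd_le_snd_one x⟩, ?_, ?_, ?_, rfl, h.padd_eq,
    fun a b ab hab => ⟨h.map_fst _ _ _ hab, h.map_snd _ _ _ hab⟩, ?_⟩
  · intro x y hxy
    obtain ⟨h1, h2⟩ := Prod.mk.inj hxy
    have hx := h.padd_eq x
    rw [h1, h2, h.padd_eq y] at hx
    exact (Option.some.inj hx).symm
  · rintro ⟨y₁, y₂⟩ (h₁ : P.ps.le y₁ _) (h₂ : P.ps.le y₂ _)
    obtain ⟨z, hz⟩ := h.exists_padd y₁ y₂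
    obtain ⟨hp, hq⟩ := h.fst_eq_and_snd_eq_of_padd hz
    exact ⟨z, Prod.ext (hp.trans (h.fst_eq_self_of_le h₁)) (hq.trans (h.snd_eq_self_of_le h₂))⟩
  · exact Prod.ext (h.fst_fst _) (h.snd_fst _)
  · intro a b s t hs hsc ht htc
    obtain ⟨z, hz⟩ := h.exists_padd s t
    rw [h.fst_eq_self_of_le hsc, h.snd_eq_self_of_le htc] at hz
    exact ⟨z, h.padd_padd_comm hs ht (h.padd_eq a) (h.padd_eq b) hz⟩

/-- Splitting the first component further by a second splitting. -/
theorem exists_comp (h : P.IsSplitting p q) (h' : P.IsSplitting p' q') :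
    ∃ r, P.IsSplitting (fun x => p' (p x)) r := by
  have hp' : ∀ x, P.ps.le (p' (p x)) (p x) := fun x => h'.fst_le _
  have hq' : ∀ x, P.ps.le (q' (p x)) (p x) := fun x => h'.symm.fst_le _
  have hpp : ∀ x, p (q' (p x)) = q' (p x) := fun x => h.fst_eq_self_of_le (hq' x)
  have hex : ∀ x, ∃ z, P.padd (q' (p x)) (q x) = some z := fun x => by
    rw [← hpp]
    exact h.exists_padd _ _
  choose r hr using hex
  refine ⟨r, fun a b ab hab => h'.map_fst _ _ _ (h.map_fst _ _ _ hab), fun a b ab hab => ?_,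
    fun x => ?_, fun x => ?_, fun x => ?_, fun x y => ?_⟩
  · refine h.padd_padd_comm (b := q' (p b)) ?_ (h.map_snd _ _ _ hab) (hr a) ?_ (hr ab)
    · rw [hpp]
      exact h'.map_snd _ _ _ (h.map_fst _ _ _ hab)
    · rw [hpp]
      exact hr b
  · obtain ⟨t, ht, hx⟩ := P.exists_assoc_right (h'.padd_eq (p x)) (h.padd_eq x)
    rwa [Option.some.inj ((hr x).symm.trans ht)]
  · have hrx := hr x
    rw [← hpp] at hrx
    change p' (p (r x)) = P.zero
    rw [(h.fst_eq_and_snd_eq_of_padd hrx).1, hpp, h'.fst_snd]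
  · have hrx := hr (p' (p x))
    rw [h.fst_eq_self_of_le (hp' x), h.snd_eq_zero_of_le (hp' x), h'.snd_fst, P.padd_zero] at hrx
    exact (Option.some.inj hrx).symm
  · obtain ⟨z, hz⟩ := h'.exists_padd (p x) (p y)
    have hzp := h.map_fst _ _ _ hz
    rw [hpp, h.fst_eq_self_of_le (hp' x), hz] at hzp
    obtain ⟨w, hw⟩ := h.exists_padd z y
    rw [← Option.some.inj hzp] at hw
    obtain ⟨t, ht, hw'⟩ := P.exists_assoc_right hz hw
    rw [← Option.some.inj ((hr y).symm.trans ht)] at hw'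
    exact ⟨w, hw'⟩

end IsSplitting

theorem isSplitting_zero_id : P.IsSplitting (fun _ => P.zero) id where
  map_fst _ _ _ _ := P.zero_padd _
  map_snd _ _ _ h := h
  padd_eq := P.zero_padd
  fst_snd _ := rfl
  snd_fst _ := rfl
  exists_padd _ y := ⟨y, P.zero_padd y⟩

theorem exists_isSplitting {c : E} (hc : P.ps.IsCentral c) :
    ∃ p q, P.IsSplitting p q ∧ p P.one = c := by
  obtain ⟨cs, hcs, f, hle, -, hsurj, hfc, hf1, hsum, hadd, -⟩ := hc
  refine ⟨fun x => (f x).1, fun x => (f x).2, ⟨fun a b ab h => (hadd a b ab h).1,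
    fun a b ab h => (hadd a b ab h).2, hsum, fun x => ?_, fun x => ?_, fun x y => ?_⟩,
    congrArg Prod.fst hf1⟩
  · have hpc : (f cs).1 = P.zero := by
      have := (hadd _ _ _ hcs).1
      rw [hfc, hf1] at this
      exact P.padd_left_cancel this (P.padd_zero c)
    obtain ⟨w, hw⟩ := (hle x).2
    have := (hadd _ _ _ hw).1
    rw [hpc] at this
    exact (P.eq_zero_of_padd_eq_zero this).1
  · obtain ⟨w, hw⟩ := (hle x).1
    have := (hadd _ _ _ hw).2
    rw [hfc] at this
    exact (P.eq_zero_of_padd_eq_zero this).1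
  · obtain ⟨z, hz⟩ := hsurj ((f x).1, (f y).2) (hle x).1 (hle y).2
    have := hsum z
    rw [hz] at this
    exact ⟨z, this⟩

theorem isCentral_zero : P.ps.IsCentral P.zero := P.isSplitting_zero_id.isCentral

/-- If `d ≤ c` are central and every element below both `e` and `c` is below `d`, then every
element below `c` and below every central element above `e` is below `d`. -/
theorem le_of_forall_isCentral {c d e x : E} (hc : P.ps.IsCentral c) (hd : P.ps.IsCentral d)
    (he : ∀ y, P.ps.le y e → P.ps.le y c → P.ps.le y d)
    (hx : ∀ g, P.ps.IsCentral g → P.ps.le e g → P.ps.le x g) (hxc : P.ps.le x c) :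
    P.ps.le x d := by
  obtain ⟨p, q, h, rfl⟩ := P.exists_isSplitting hc
  obtain ⟨p', q', h', rfl⟩ := P.exists_isSplitting hd
  obtain ⟨r, hr⟩ := h.exists_comp h'.symm
  have her : q' (p e) = P.zero := by
    have hle := he _ (P.le_trans (h'.symm.fst_le (p e)) (h.fst_le e))
      (P.le_trans (h'.symm.fst_le (p e)) (h.fst_le_fst_one e))
    rw [← h'.snd_snd]
    exact h'.snd_eq_zero_of_le hle
  have hxr : P.ps.le x (r P.one) := by
    refine hx _ hr.symm.isCentral ?_
    rw [← hr.snd_eq_self her]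
    exact hr.snd_le_snd_one e
  have hx0 := hr.fst_eq_zero_of_le hxr
  rw [h.fst_eq_self_of_le hxc] at hx0
  rw [← h'.fst_eq_self hx0]
  exact h'.fst_le_fst_one x

end PEApaper.PEA

open PEApaper PEApaper.PartialStruct in
/-- Theorem 4.10: in a COPEA, the central cover map `γ` is a surjective hull
mapping: `γ0 = 0`, `e ≤ γe`, `γ(e ∧ γf) = γe ∧ γf`, and `γE = Γ(E)`. -/
theorem stmt9 {E : Type} (P : PEA E) (hco : P.ps.IsCOPEA)
    (γ : E → E) (hγ : ∀ e, P.ps.IsCentralCover (γ e) e) :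
    γ P.ps.zero = P.ps.zero ∧
    (∀ e, P.ps.le e (γ e)) ∧
    (∀ e f m, P.ps.IsMeet e (γ f) m → P.ps.IsMeet (γ e) (γ f) (γ m)) ∧
    (∀ c, P.ps.IsCentral c → ∃ e, γ e = c) := by
  refine ⟨?_, fun e => (hγ e).2.1, fun e f m hm => ?_, fun c hc => ⟨c, ?_⟩⟩
  · exact P.eq_zero_of_le_zero ((hγ _).2.2 _ P.isCentral_zero (P.le_refl _))
  · obtain ⟨hme, hmf, hmax⟩ := hm
    refine ⟨(hγ m).2.2 _ (hγ e).1 (P.le_trans hme (hγ e).2.1), (hγ m).2.2 _ (hγ f).1 hmf,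
      fun x hxe hxf => ?_⟩
    exact P.le_of_forall_isCentral (hγ f).1 (hγ m).1
      (fun y hye hyf => P.le_trans (hmax y hye hyf) (hγ m).2.1)
      (fun g hg heg => P.le_trans hxe ((hγ e).2.2 g hg heg)) hxf
  · exact P.le_antisymm ((hγ c).2.2 c hc (P.le_refl c)) (hγ c).2.1
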